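/- Let A be a C*-algebra and let a, b, c ∈ A with 0 ≤ a ≤ 1, 0 ≤ b, 0 ≤ c, ‖b‖ ≤ 1, ‖c‖ ≤ 1, and a ≤ b + c. Then for every δ ∈ (0, 1/2), the 2×2 diagonal matrix diag(f_δ(a), 0) is Cuntz subequivalent in M₂(A) to the diagonal matrix diag(f_{δ/4}(b), f_{δ/4}(c)). -/

import Mathlib

-- Equip `M₂(A)` with the (L∞-operator) norm; its topology coincides with that of the
-- unique C*-norm on `M₂(A)`, so the Cuntz subequivalence relation below is the usual one.
attribute [local instance] Matrix.linftyOpNonUnitalNormedRing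

/-- The cut-off function `f_ε : ℝ → ℝ`: it is `0` on `(-∞, ε/2]`, `1` on `[ε, ∞)`,
and linear on `[ε/2, ε]` (for `ε > 0`). -/
noncomputable def fcut (ε : ℝ) : ℝ → ℝ := fun t => min 1 (max 0 ((t - ε / 2) / (ε / 2)))

variable {A : Type*} [NonUnitalCStarAlgebra A] [PartialOrder A] [StarOrderedRing A]

/-- Cuntz subequivalence `x ≾ y` of elements of `M₂(A)`:
for every `ε > 0` there is `r` with `‖x − r* y r‖ < ε`. -/
def CuntzLE (x y : Matrix (Fin 2) (Fin 2) A) : Prop :=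
  ∀ ε > (0 : ℝ), ∃ r : Matrix (Fin 2) (Fin 2) A, ‖x - star r * y * r‖ < ε

/-- Compressing `x ≤ y` by `1 - p` preserves the norm ordering, phrased with square roots `s` of `x`
and `u` of `y`. -/
lemma norm_sub_mul_le_of_mul_self_le {s u p : A} (hs : IsSelfAdjoint s) (hu : IsSelfAdjoint u)
    (hp : IsSelfAdjoint p) (h : s * s ≤ u * u) : ‖s - s * p‖ ≤ ‖u - u * p‖ := by
  have expand : ∀ v : A, IsSelfAdjoint v →
      star (v - v * p) * (v - v * p) =
        v * v - p * (v * v) - v * v * p + p * (v * v) * p := by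
    intro v hv
    simp only [star_sub, star_mul, hv.star_eq, hp.star_eq]
    noncomm_ring
  have hw := CFC.sqrt_mul_sqrt_self (u * u - s * s) (sub_nonneg.2 h)
  have hle : star (s - s * p) * (s - s * p) ≤ star (u - u * p) * (u - u * p) := by
    have h0 := star_mul_self_nonneg
      (CFC.sqrt (u * u - s * s) - CFC.sqrt (u * u - s * s) * p)
    rw [expand _ (.of_nonneg (CFC.sqrt_nonneg _)), hw] at h0
    rw [← sub_nonneg, expand s hs, expand u hu]
    convert h0 using 1
    noncomm_ring
  have hn := CStarAlgebra.norm_le_norm_of_nonneg_of_le (star_mul_self_nonneg _) hle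
  rw [CStarRing.norm_star_mul_self, CStarRing.norm_star_mul_self] at hn
  exact le_of_not_gt fun hlt => absurd hn (not_le.2 (mul_self_lt_mul_self (norm_nonneg _) hlt))

/-- A positive element dominated by `y` is Cuntz subequivalent to `y`. -/
lemma exists_norm_sub_star_mul_mul_lt {x y : A} (hx : 0 ≤ x) (hxy : x ≤ y) {ε : ℝ} (hε : 0 < ε) :
    ∃ r : A, ‖x - star r * y * r‖ < ε := by
  have hy : 0 ≤ y := hx.trans hxy
  set s := CFC.sqrt x
  have hs : IsSelfAdjoint s := .of_nonneg (CFC.sqrt_nonneg _)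
  have hss : s * s = x := CFC.sqrt_mul_sqrt_self x hx
  obtain ⟨κ, hκ, hκε⟩ : ∃ κ : ℝ, 0 < κ ∧ 2 * ‖s‖ * κ + κ * κ < ε := by
    have ht : Filter.Tendsto (fun κ : ℝ => 2 * ‖s‖ * κ + κ * κ) (nhds 0) (nhds 0) := by
      have : Continuous (fun κ : ℝ => 2 * ‖s‖ * κ + κ * κ) := by fun_prop
      simpa using this.tendsto 0
    have h1 := (ht.eventually (gt_mem_nhds hε)).filter_mono (nhdsWithin_le_nhds (s := Set.Ioi 0))
    obtain ⟨κ, h2, h3⟩ := (h1.and self_mem_nhdsWithin).exists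
    exact ⟨κ, h3, h2⟩
  have hden : ∀ t : ℝ, |t| + κ ^ 2 ≠ 0 := fun t => by positivity
  have hcφ : Continuous fun t : ℝ => √t / (|t| + κ ^ 2) := by fun_prop (disch := exact hden _)
  have hcp : Continuous fun t : ℝ => t / (|t| + κ ^ 2) := by fun_prop (disch := exact hden _)
  have hcs : Continuous fun t : ℝ => √t := by fun_prop
  set φ := cfcₙ (fun t : ℝ => √t / (|t| + κ ^ 2)) y with hφ_def
  set p := cfcₙ (fun t : ℝ => t / (|t| + κ ^ 2)) y with hp_def
  set u := cfcₙ (fun t : ℝ => √t) y with hu_def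
  have hφ : IsSelfAdjoint φ := cfcₙ_predicate _ _
  have hp : IsSelfAdjoint p := cfcₙ_predicate _ _
  have hu : IsSelfAdjoint u := cfcₙ_predicate _ _
  have huu : u * u = y := by
    rw [hu_def, ← cfcₙ_mul _ _ y hcs.continuousOn (by simp) hcs.continuousOn (by simp)]
    conv_rhs => rw [← cfcₙ_id' ℝ y]
    exact cfcₙ_congr fun t ht => Real.mul_self_sqrt (quasispectrum_nonneg_of_nonneg y hy t ht)
  have huφ : u * φ = p := by
    rw [hu_def, hφ_def, ← cfcₙ_mul _ _ y hcs.continuousOn (by simp) hcφ.continuousOn (by simp)]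
    refine cfcₙ_congr fun t ht => ?_
    rw [← mul_div_assoc, Real.mul_self_sqrt (quasispectrum_nonneg_of_nonneg y hy t ht)]
  have hφu : φ * u = p := by
    simpa [hu.star_eq, hφ.star_eq, hp.star_eq] using congrArg star huφ
  have hnorm : ‖u - u * p‖ ≤ κ := by
    rw [hu_def, hp_def, ← cfcₙ_mul _ _ y hcs.continuousOn (by simp) hcp.continuousOn (by simp),
      ← cfcₙ_sub _ _ y hcs.continuousOn (by simp) (by fun_prop (disch := exact hden _)) (by simp)]
    refine norm_cfcₙ_le fun t ht => ?_
    have ht0 : 0 ≤ t := quasispectrum_nonneg_of_nonneg y hy t ht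
    have hd : 0 < t + κ ^ 2 := by positivity
    have : √t - √t * (t / (|t| + κ ^ 2)) = √t * κ ^ 2 / (t + κ ^ 2) := by
      rw [abs_of_nonneg ht0]
      field_simp
      ring
    rw [this, Real.norm_of_nonneg (by positivity), div_le_iff₀ hd]
    have hsq := Real.sq_sqrt ht0
    nlinarith [mul_nonneg hκ.le (sq_nonneg (√t - κ)), mul_nonneg hκ.le (sq_nonneg (√t)),
      mul_nonneg hκ.le (sq_nonneg κ)]
  have hE : ‖s - s * p‖ ≤ κ :=
    (norm_sub_mul_le_of_mul_self_le hs hu hp (by rwa [hss, huu])).trans hnorm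
  refine ⟨φ * s, lt_of_le_of_lt ?_ hκε⟩
  have hr : star (φ * s) * y * (φ * s) = s * p * star (s * p) := by
    rw [star_mul, star_mul, hs.star_eq, hφ.star_eq, hp.star_eq, ← huu]
    calc s * φ * (u * u) * (φ * s) = s * (φ * u) * ((u * φ) * s) := by noncomm_ring
      _ = _ := by rw [hφu, huφ]
  have key : x - star (φ * s) * y * (φ * s) =
      s * star (s - s * p) + (s - s * p) * s - (s - s * p) * star (s - s * p) := by
    rw [hr, ← hss]
    simp only [star_sub, star_mul, hs.star_eq, hp.star_eq]
    noncomm_ring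
  rw [key]
  calc _ ≤ ‖s‖ * ‖s - s * p‖ + ‖s - s * p‖ * ‖s‖ + ‖s - s * p‖ * ‖s - s * p‖ := by
        have h1 := norm_mul_le s (star (s - s * p))
        have h2 := norm_mul_le (s - s * p) s
        have h3 := norm_mul_le (s - s * p) (star (s - s * p))
        rw [norm_star] at h1 h3
        refine (norm_sub_le _ _).trans ?_
        grw [norm_add_le, h1, h2, h3]
    _ ≤ ‖s‖ * κ + κ * ‖s‖ + κ * κ := by gcongr
    _ = _ := by ring

lemma continuous_fcut (ε : ℝ) : Continuous (fcut ε) := by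
  unfold fcut
  fun_prop

lemma fcut_of_le {ε t : ℝ} (hε : 0 < ε) (ht : t ≤ ε / 2) : fcut ε t = 0 := by
  have : (t - ε / 2) / (ε / 2) ≤ 0 := div_nonpos_of_nonpos_of_nonneg (by linarith) (by linarith)
  simp [fcut, max_eq_left this]

lemma fcut_zero {ε : ℝ} (hε : 0 < ε) : fcut ε 0 = 0 := fcut_of_le hε (by linarith)

lemma fcut_nonneg (ε t : ℝ) : 0 ≤ fcut ε t := le_min zero_le_one (le_max_left _ _)

lemma sub_le_fcut {ε t : ℝ} (hε : 0 < ε) (hε2 : ε ≤ 2) (ht : t ≤ 1) : t - ε / 2 ≤ fcut ε t := by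
  refine le_min (by linarith) ?_
  rcases le_total t (ε / 2) with h | h
  · exact (by linarith : t - ε / 2 ≤ 0).trans (le_max_left _ _)
  · refine le_trans ?_ (le_max_right _ _)
    rw [le_div_iff₀ (by linarith)]
    nlinarith

/-- Conjugating a positive contraction by `h` costs at most `ε / 2` when it is cut off by
`fcut ε`. -/
lemma conjugate_le_conjugate_fcut_add {b h : A} (hb0 : 0 ≤ b) (hb : ‖b‖ ≤ 1)
    (hh : IsSelfAdjoint h) {ε : ℝ} (hε : 0 < ε) (hε2 : ε ≤ 2) :
    h * b * h ≤ h * cfcₙ (fcut ε) b * h + (ε / 2) • (h * h) := by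
  have hcm : Continuous fun t : ℝ => min t (ε / 2) := by fun_prop
  have h0 : min (0 : ℝ) (ε / 2) = 0 := min_eq_left (by linarith)
  have hd : b ≤ cfcₙ (fcut ε) b + cfcₙ (fun t : ℝ => min t (ε / 2)) b := by
    rw [← cfcₙ_add _ _ b (continuous_fcut ε).continuousOn (fcut_zero hε) hcm.continuousOn h0]
    conv_lhs => rw [← cfcₙ_id' ℝ b]
    refine cfcₙ_mono (fun t ht => ?_) continuousOn_id
      ((continuous_fcut ε).add hcm).continuousOn rfl (by simp [fcut_zero hε, h0])
    have ht1 : t ≤ 1 := by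
      have hle := norm_apply_le_norm_cfcₙ (fun t : ℝ => t) b ht
      rw [cfcₙ_id' ℝ b] at hle
      exact (le_abs_self t).trans (hle.trans hb)
    rcases min_cases t (ε / 2) with ⟨h1, -⟩ | ⟨h1, -⟩ <;> rw [h1]
    · linarith [fcut_nonneg ε t]
    · linarith [sub_le_fcut hε hε2 ht1]
  have hn : ‖cfcₙ (fun t : ℝ => min t (ε / 2)) b‖ ≤ ε / 2 := by
    refine norm_cfcₙ_le fun t ht => ?_
    have ht0 : 0 ≤ t := quasispectrum_nonneg_of_nonneg b hb0 t ht
    rw [Real.norm_of_nonneg (le_min ht0 (by linarith))]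
    exact min_le_right _ _
  have hh0 : 0 ≤ h * h := by simpa [hh.star_eq] using star_mul_self_nonneg h
  calc h * b * h ≤ h * (cfcₙ (fcut ε) b + cfcₙ (fun t : ℝ => min t (ε / 2)) b) * h :=
        hh.conjugate_le_conjugate hd
    _ = h * cfcₙ (fcut ε) b * h + h * cfcₙ (fun t : ℝ => min t (ε / 2)) b * h := by
        noncomm_ring
    _ ≤ _ := by
        gcongr
        have := CStarAlgebra.star_left_conjugate_le_norm_smul (a := h)
          (b := cfcₙ (fun t : ℝ => min t (ε / 2)) b) (cfcₙ_predicate _ _)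
        rw [hh.star_eq] at this
        exact this.trans (smul_le_smul_of_nonneg_right hn hh0)

/-- If `a ≤ b + c` with `b`, `c` positive contractions, then `f_δ(a)` is dominated by a conjugate of
`f_{δ/4}(b) + f_{δ/4}(c)`. -/
lemma exists_cfcₙ_fcut_le_conjugate {a b c : A} (ha0 : 0 ≤ a) (hb0 : 0 ≤ b) (hc0 : 0 ≤ c)
    (hb : ‖b‖ ≤ 1) (hc : ‖c‖ ≤ 1) (habc : a ≤ b + c) {δ : ℝ} (hδ : 0 < δ) (hδ2 : δ ≤ 8) :
    ∃ h : A, IsSelfAdjoint h ∧ cfcₙ (fcut δ) a ≤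
      h * (cfcₙ (fcut (δ / 4)) b + cfcₙ (fcut (δ / 4)) c) * h := by
  have hcf := continuous_fcut δ
  have hcg : Continuous fun t : ℝ => √(4 / δ * fcut δ t) := by fun_prop
  have hg0 : √(4 / δ * fcut δ 0) = 0 := by simp [fcut_zero hδ]
  set h := cfcₙ (fun t : ℝ => √(4 / δ * fcut δ t)) a with h_def
  have hh : IsSelfAdjoint h := cfcₙ_predicate _ _
  refine ⟨h, hh, ?_⟩
  have hhh : h * h = cfcₙ (fun t : ℝ => 4 / δ * fcut δ t) a := by
    rw [h_def, ← cfcₙ_mul _ _ a hcg.continuousOn hg0 hcg.continuousOn hg0]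
    exact cfcₙ_congr fun t _ => Real.mul_self_sqrt (mul_nonneg (by positivity) (fcut_nonneg _ _))
  have hhah : h * a * h = cfcₙ (fun t : ℝ => 4 / δ * fcut δ t * t) a := by
    have hcomm : a * h = h * a := by
      rw [h_def]
      nth_rw 1 4 [← cfcₙ_id' ℝ a]
      exact cfcₙ_commute_cfcₙ _ _ _
    rw [mul_assoc, hcomm, ← mul_assoc, hhh]
    nth_rw 2 [← cfcₙ_id' ℝ a]
    rw [← cfcₙ_mul _ _ a (by fun_prop) (by simp [fcut_zero hδ]) (by fun_prop) rfl]
  have hfa : cfcₙ (fcut δ) a + (δ / 4) • (h * h) ≤ h * a * h := by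
    rw [hhah, hhh, ← cfcₙ_smul _ _ a (by fun_prop) (by simp [fcut_zero hδ]),
      ← cfcₙ_add _ _ a hcf.continuousOn (fcut_zero hδ) (by fun_prop) (by simp [fcut_zero hδ])]
    refine cfcₙ_mono (fun t _ => ?_) (by fun_prop) (by fun_prop) (by simp [fcut_zero hδ])
      (by simp)
    rcases le_total t (δ / 2) with ht | ht
    · simp [fcut_of_le hδ ht]
    · have h1 : 2 * fcut δ t ≤ 4 / δ * fcut δ t * t := by
        calc 2 * fcut δ t = 4 / δ * fcut δ t * (δ / 2) := by field_simp; ring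
          _ ≤ _ := mul_le_mul_of_nonneg_left ht
            (mul_nonneg (by positivity) (fcut_nonneg _ _))
      have h2 : (δ / 4) • (4 / δ * fcut δ t) = fcut δ t := by
        rw [smul_eq_mul]
        field_simp
      simp only [h2]
      linarith
  have h1 := hh.conjugate_le_conjugate habc
  have h2 := conjugate_le_conjugate_fcut_add hb0 hb hh (ε := δ / 4) (by linarith) (by linarith)
  have h3 := conjugate_le_conjugate_fcut_add hc0 hc hh (ε := δ / 4) (by linarith) (by linarith)
  have h4 : (δ / 4) • (h * h) = (δ / 4 / 2) • (h * h) + (δ / 4 / 2) • (h * h) := by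
    rw [← add_smul, add_halves]
  refine le_of_add_le_add_right (a := (δ / 4) • (h * h)) (hfa.trans (h1.trans ?_))
  rw [mul_add, add_mul, mul_add, add_mul, h4]
  exact (add_le_add h2 h3).trans_eq (by abel)

/-- Lemma 7.1 of the paper (second part).  If `0 ≤ a ≤ 1`, `0 ≤ b`, `0 ≤ c`,
`‖b‖ ≤ 1`, `‖c‖ ≤ 1` and `a ≤ b + c`, then for every `δ ∈ (0, 1/2)`,
`diag(f_δ(a), 0) ≾ diag(f_{δ/4}(b), f_{δ/4}(c))` in `M₂(A)`. -/
theorem stmt8 (a b c : A) (ha0 : 0 ≤ a) (ha1 : ‖a‖ ≤ 1)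
    (hb0 : 0 ≤ b) (hc0 : 0 ≤ c) (hb : ‖b‖ ≤ 1) (hc : ‖c‖ ≤ 1)
    (h : a ≤ b + c) :
    ∀ δ : ℝ, 0 < δ → δ < 1 / 2 →
      CuntzLE (Matrix.diagonal ![cfcₙ (fcut δ) a, 0])
        (Matrix.diagonal ![cfcₙ (fcut (δ / 4)) b, cfcₙ (fcut (δ / 4)) c]) := by
  intro δ hδ hδ2 ε hε
  obtain ⟨k, hk, hle⟩ := exists_cfcₙ_fcut_le_conjugate ha0 hb0 hc0 hb hc h hδ (by linarith)
  have hf0 : 0 ≤ cfcₙ (fcut δ) a := cfcₙ_nonneg fun t _ => fcut_nonneg δ t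
  obtain ⟨r, hr⟩ := exists_norm_sub_star_mul_mul_lt hf0 hle hε
  refine ⟨!![k * r, 0; k * r, 0], ?_⟩
  have hmat : Matrix.diagonal ![cfcₙ (fcut δ) a, 0] -
      star !![k * r, 0; k * r, 0] *
        Matrix.diagonal ![cfcₙ (fcut (δ / 4)) b, cfcₙ (fcut (δ / 4)) c] *
        !![k * r, 0; k * r, 0] =
      Matrix.diagonal ![cfcₙ (fcut δ) a - star r *
        (k * (cfcₙ (fcut (δ / 4)) b + cfcₙ (fcut (δ / 4)) c) * k) * r, 0] := by
    ext i j
    fin_cases i <;> fin_cases j <;>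
      simp [Matrix.mul_apply, Matrix.star_apply, Fin.sum_univ_two, hk.star_eq]
    noncomm_ring
  rw [hmat, Matrix.linfty_opNorm_diagonal]
  refine lt_of_le_of_lt ((pi_norm_le_iff_of_nonneg (norm_nonneg _)).2 fun i => ?_) hr
  fin_cases i <;> simp
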